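/- Fix a permutation π of V, J ∈ V, and an integer m ≥ 1. Suppose a^J_I = 0 for every I ∈ V with Hamming weight |I| > m. Then the number of nonzero coefficients is bounded by 2^{2m−2}: the cardinality of {g ∈ V : a^J_g ≠ 0} is at most 2^{2m−2}. -/

import Mathlib

open Finset

/-- Hamming weight of an n-bit vector. -/
def wt {n : ℕ} (v : Fin n → ZMod 2) : ℕ :=
  (Finset.univ.filter (fun i => v i = 1)).card

/-- The sign (-1)^{u·v} ∈ ℝ. -/
noncomputable def sgn {n : ℕ} (u v : Fin n → ZMod 2) : ℝ :=
  if (∑ i, u i * v i) = (1 : ZMod 2) then -1 else 1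

/-- Fourier coefficient a^J_I, for a permutation π of V = Fin n → ZMod 2. -/
noncomputable def fc {n : ℕ} (π : Equiv.Perm (Fin n → ZMod 2))
    (J I : Fin n → ZMod 2) : ℝ :=
  (1 / 2 ^ n) * ∑ x : Fin n → ZMod 2, sgn I x * sgn (π x) J

/-- integer sign of a bit -/
def sbit (c : ZMod 2) : ℤ := if c = 1 then -1 else 1

lemma sbit_add : ∀ a b : ZMod 2, sbit (a + b) = sbit a * sbit b := by decide

lemma sbit_sum {ι : Type*} (s : Finset ι) (f : ι → ZMod 2) :
    sbit (∑ i ∈ s, f i) = ∏ i ∈ s, sbit (f i) := by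
  classical
  induction s using Finset.induction_on with
  | empty => simp [sbit]
  | insert a s ha ih => rw [Finset.sum_insert ha, Finset.prod_insert ha, sbit_add, ih]

lemma sgn_eq {n : ℕ} (u v : Fin n → ZMod 2) :
    sgn u v = ((∏ i, sbit (u i * v i) : ℤ) : ℝ) := by
  rw [← sbit_sum]
  unfold sgn sbit
  split_ifs <;> simp

/-- all vectors above `I` -/
def upF {n : ℕ} (I : Fin n → ZMod 2) : Finset (Fin n → ZMod 2) :=
  Fintype.piFinset (fun i => if I i = 1 then {1} else Finset.univ)

/-- the kernel of the sum over `upF I` -/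
def ker0 {n : ℕ} (I x : Fin n → ZMod 2) : ℤ :=
  ∏ i, if I i = 1 then sbit (x i) else if x i = 0 then 1 else 0

lemma two_pow_wt {n : ℕ} (I : Fin n → ZMod 2) :
    (2 : ℤ) ^ wt I = ∏ i, if I i = 1 then (2 : ℤ) else 1 := by
  unfold wt
  rw [Finset.prod_ite]
  simp

lemma sum_up {n : ℕ} (I x : Fin n → ZMod 2) :
    (2 : ℤ) ^ wt I * ∑ g ∈ upF I, ∏ i, sbit (g i * x i) = 2 ^ n * ker0 I x := by
  unfold upF ker0
  rw [← Finset.prod_univ_sum (fun i => if I i = 1 then {1} else Finset.univ)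
    (fun i c => sbit (c * x i)), two_pow_wt, ← Finset.prod_mul_distrib]
  have h2 : (2 : ℤ) ^ n = ∏ _i : Fin n, 2 := by simp
  rw [h2, ← Finset.prod_mul_distrib]
  refine Finset.prod_congr rfl fun i _ => ?_
  generalize I i = a
  generalize x i = b
  revert a b
  decide

lemma sum_ker0 {n : ℕ} (I : Fin n → ZMod 2) (h : wt I ≠ 0) :
    ∑ x, ker0 I x = 0 := by
  unfold ker0
  have := Finset.prod_univ_sum (fun _ : Fin n => (Finset.univ : Finset (ZMod 2)))
    (fun i c => if I i = 1 then sbit c else if c = 0 then 1 else 0)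
  rw [Fintype.piFinset_univ] at this
  rw [← this]
  unfold wt at h
  obtain ⟨i, hi⟩ := Finset.card_ne_zero.1 h
  simp only [Finset.mem_filter, Finset.mem_univ, true_and] at hi
  apply Finset.prod_eq_zero (Finset.mem_univ i)
  simp only [hi, if_true]
  decide

lemma up_sum_fc {n : ℕ} (π : Equiv.Perm (Fin n → ZMod 2)) (J I : Fin n → ZMod 2) :
    (2 : ℝ) ^ wt I * ∑ g ∈ upF I, fc π J g
      = ((∑ x, ker0 I x * sbit (∑ i, π x i * J i) : ℤ) : ℝ) := by
  have hs : ∀ u v : Fin n → ZMod 2, sgn u v = ((sbit (∑ i, u i * v i) : ℤ) : ℝ) := by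
    intro u v; rw [sgn_eq, sbit_sum]
  unfold fc
  rw [← Finset.mul_sum, Finset.sum_comm]
  have h2 : (2 : ℝ) ^ n ≠ 0 := by positivity
  rw [mul_left_comm, Finset.mul_sum, Finset.mul_sum]
  push_cast
  refine Finset.sum_congr rfl fun x _ => ?_
  rw [← Finset.sum_mul, hs (π x) J, ← mul_assoc, ← mul_assoc]
  congr 1
  have := congrArg (fun z : ℤ => (z : ℝ)) (sum_up I x)
  simp only [sgn_eq]
  push_cast at this ⊢
  rw [mul_assoc, this]
  field_simp

lemma up_int {n : ℕ} (π : Equiv.Perm (Fin n → ZMod 2)) (J I : Fin n → ZMod 2)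
    (m : ℕ) (hm : 1 ≤ m) (hI : wt I ≤ m) :
    ∃ z : ℤ, (2 : ℝ) ^ (m - 1) * ∑ g ∈ upF I, fc π J g = z := by
  have key := up_sum_fc π J I
  by_cases h : wt I = 0
  · rw [h, pow_zero, one_mul] at key
    rw [key]
    exact ⟨2 ^ (m - 1) * ∑ x, ker0 I x * sbit (∑ i, π x i * J i), by push_cast; rfl⟩
  · have hb : ∀ c : ZMod 2, sbit c = 1 + 2 * (if c = 1 then -1 else 0) := by decide
    have hk : ∑ x, ker0 I x * sbit (∑ i, π x i * J i)
        = 2 * ∑ x, ker0 I x * (if (∑ i, π x i * J i) = 1 then -1 else 0) := by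
      refine Eq.trans ?_ ((congrArg (· + _) (sum_ker0 I h)).trans (zero_add _))
      rw [Finset.mul_sum, ← Finset.sum_add_distrib]
      refine Finset.sum_congr rfl fun x _ => ?_
      rw [hb]; ring
    rw [hk] at key
    generalize (∑ x, ker0 I x * (if (∑ i, π x i * J i) = 1 then (-1 : ℤ) else 0)) = w at key
    obtain ⟨k, hk⟩ : ∃ k, wt I = k + 1 := ⟨wt I - 1, by omega⟩
    obtain ⟨d, hd⟩ : ∃ d, m - 1 = d + k := ⟨m - 1 - k, by omega⟩
    refine ⟨2 ^ d * w, ?_⟩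
    rw [hk, pow_succ] at key
    rw [hd, pow_add]
    push_cast at key ⊢
    linear_combination (2 : ℝ) ^ d / 2 * key

lemma mem_upF {n : ℕ} (I g : Fin n → ZMod 2) : g ∈ upF I ↔ ∀ i, I i = 1 → g i = 1 := by
  unfold upF
  rw [Fintype.mem_piFinset]
  refine forall_congr' fun i => ?_
  split_ifs with h <;> simp [h]

lemma wt_lt {n : ℕ} (I g : Fin n → ZMod 2) (h : g ∈ upF I) (hne : g ≠ I) : wt I < wt g := by
  rw [mem_upF] at h
  unfold wt
  apply Finset.card_lt_card
  rw [Finset.ssubset_iff_of_subset (fun i => by simpa using h i)]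
  by_contra hc
  push Not at hc
  apply hne
  funext i
  have h1 := h i
  have h2 := hc i
  simp only [Finset.mem_filter, Finset.mem_univ, true_and] at h2
  generalize g i = a at *
  generalize I i = b at *
  revert a b
  decide

lemma fc_int {n : ℕ} (π : Equiv.Perm (Fin n → ZMod 2)) (J : Fin n → ZMod 2)
    (m : ℕ) (hm : 1 ≤ m)
    (hloc : ∀ I : Fin n → ZMod 2, m < wt I → fc π J I = 0) :
    ∀ (k : ℕ) (I : Fin n → ZMod 2), m < wt I + k → ∃ z : ℤ, (2 : ℝ) ^ (m - 1) * fc π J I = z := by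
  intro k
  induction k with
  | zero => intro I h; exact ⟨0, by rw [hloc I h]; simp⟩
  | succ k ih =>
    intro I h
    by_cases hI : m < wt I
    · exact ⟨0, by rw [hloc I hI]; simp⟩
    obtain ⟨z, hz⟩ := up_int π J I m hm (by omega)
    have hmem : I ∈ upF I := by rw [mem_upF]; exact fun _ h => h
    rw [← Finset.add_sum_erase _ _ hmem, mul_add, Finset.mul_sum] at hz
    have : ∀ g : Fin n → ZMod 2, ∃ w : ℤ, g ∈ (upF I).erase I → (2 : ℝ) ^ (m - 1) * fc π J g = w := by
      intro g
      by_cases hg : g ∈ (upF I).erase I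
      · rw [Finset.mem_erase] at hg
        have := wt_lt I g hg.2 hg.1
        obtain ⟨w, hw⟩ := ih g (by omega)
        exact ⟨w, fun _ => hw⟩
      · exact ⟨0, fun h => absurd h hg⟩
    choose w hw using this
    rw [Finset.sum_congr rfl hw] at hz
    refine ⟨z - ∑ g ∈ (upF I).erase I, w g, ?_⟩
    push_cast
    linarith

lemma sum_char {n : ℕ} (x y : Fin n → ZMod 2) :
    ∑ g, sgn g x * sgn g y = if x = y then (2 : ℝ) ^ n else 0 := by
  have h := Finset.prod_univ_sum (fun _ : Fin n => (Finset.univ : Finset (ZMod 2)))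
    (fun i c => sbit (c * x i) * sbit (c * y i))
  rw [Fintype.piFinset_univ] at h
  simp only [sgn_eq]
  simp only [Finset.prod_mul_distrib] at h
  have h3 : ∀ a b : ZMod 2, ∑ c, sbit (c * a) * sbit (c * b) = if a = b then 2 else 0 := by decide
  simp only [h3] at h
  have h4 := congrArg (fun z : ℤ => (z : ℝ)) h
  push_cast at h4 ⊢
  rw [← h4]
  split_ifs with hxy
  · simp [hxy]
  · obtain ⟨i, hi⟩ := Function.ne_iff.1 hxy
    exact Finset.prod_eq_zero (Finset.mem_univ i) (by simp [hi])

lemma parseval {n : ℕ} (π : Equiv.Perm (Fin n → ZMod 2)) (J : Fin n → ZMod 2) :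
    ∑ g, fc π J g ^ 2 = 1 := by
  have h2 : (2 : ℝ) ^ n ≠ 0 := by positivity
  have hsq : ∀ u v : Fin n → ZMod 2, sgn u v * sgn u v = 1 := by
    intro u v; unfold sgn; split_ifs <;> norm_num
  have : ∀ g, fc π J g ^ 2 = (1 / 2 ^ n) ^ 2 *
      ∑ x, ∑ y, (sgn g x * sgn g y) * (sgn (π x) J * sgn (π y) J) := by
    intro g
    unfold fc
    rw [mul_pow, sq (∑ x, _), Finset.sum_mul_sum]
    congr 1
    refine Finset.sum_congr rfl fun x _ => Finset.sum_congr rfl fun y _ => by ring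
  simp only [this]
  rw [← Finset.mul_sum, Finset.sum_comm]
  have h5 : ∀ x : Fin n → ZMod 2,
      ∑ g, ∑ y, (sgn g x * sgn g y) * (sgn (π x) J * sgn (π y) J) = 2 ^ n := by
    intro x
    rw [Finset.sum_comm]
    simp only [← Finset.sum_mul, sum_char]
    simp [hsq]
  simp only [h5]
  simp
  field_simp

open Classical in
/-- If all Fourier coefficients of J vanish above locality m, then at most 2^(2m-2)
coefficients are nonzero (bound A_m). -/
theorem fc_support_bound {n : ℕ} (hn : 1 ≤ n) (π : Equiv.Perm (Fin n → ZMod 2))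
    (J : Fin n → ZMod 2) (m : ℕ) (hm : 1 ≤ m)
    (hloc : ∀ I : Fin n → ZMod 2, m < wt I → fc π J I = 0) :
    (Finset.univ.filter (fun g : Fin n → ZMod 2 => fc π J g ≠ 0)).card
      ≤ 2 ^ (2 * m - 2) := by
  have hge : ∀ g ∈ Finset.univ.filter (fun g : Fin n → ZMod 2 => fc π J g ≠ 0),
      (1 : ℝ) ≤ 2 ^ (2 * m - 2) * fc π J g ^ 2 := by
    intro g hg
    simp only [Finset.mem_filter, Finset.mem_univ, true_and] at hg
    obtain ⟨z, hz⟩ := fc_int π J m hm hloc (m + 1) g (by omega)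
    have hz0 : z ≠ 0 := by
      rintro rfl
      have : (2 : ℝ) ^ (m - 1) ≠ 0 := by positivity
      simp_all
    have e : 2 * m - 2 = (m - 1) * 2 := by omega
    rw [e, pow_mul, ← mul_pow, hz]
    have : 1 ≤ z ^ 2 := by have := sq_pos_of_ne_zero hz0; omega
    exact_mod_cast this
  have h := Finset.card_nsmul_le_sum _ _ _ hge
  rw [← Finset.mul_sum] at h
  have h6 : ∑ g ∈ Finset.univ.filter (fun g : Fin n → ZMod 2 => fc π J g ≠ 0), fc π J g ^ 2 ≤ 1 := by
    rw [← parseval π J]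
    exact Finset.sum_le_sum_of_subset_of_nonneg (Finset.filter_subset _ _)
      (fun _ _ _ => sq_nonneg _)
  have h7 : (0 : ℝ) < 2 ^ (2 * m - 2) := by positivity
  rw [nsmul_eq_mul, mul_one] at h
  have h8 := h.trans (mul_le_of_le_one_right h7.le h6)
  exact_mod_cast h8
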